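/- arXiv:2507.21604 — 4 statements merged into one kernel-verified Lean document; each statement's English description precedes it below -/
import Mathlib

section
/- Let (M,d,μ) be a metric measure space satisfying the volume doubling property (VD), let W be a scaling function with constants C_W, β1, β2, and let J : M × M → [0,∞] be a measurable symmetric function (J(x,y) = J(y,x)). Assume (UJS): there is C_U > 0 such that for μ-a.e. x,y ∈ M with x ≠ y and every 0 < r ≤ d(x,y)/2, J(x,y) ≤ (C_U/V(x,r))·∫_{B(x,r)} J(z,y) dμ(z); and assume (TJ): for every λ ∈ (0,1) there is C_λ > 0 such that for every ball B = B(x₀,R), ess sup_{x ∈ λB} ∫_{M∖B} J(x,y) dμ(y) ≤ C_λ/W(x₀,R). Then (J≤) holds: there exists C > 0 such that for μ⊗μ-a.e. (x,y) with x ≠ y, J(x,y) ≤ C/(V(x,d(x,y))·W(x,d(x,y))). -/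
open MeasureTheory Metric Set
open scoped ENNReal

/-- The tail bound on countably many balls yields, off a single null set, a tail bound at every
radius, with a comparison ball whose centre and radius are close to the given ones. -/
lemma ae_forall_tail_le {M : Type*} [PseudoMetricSpace M] [MeasurableSpace M]
    [OpensMeasurableSpace M] [TopologicalSpace.SeparableSpace M] (μ : Measure M)
    (J : M → M → ℝ≥0∞) (T : M → ℝ → ℝ≥0∞)
    (hT : ∀ (x₀ : M) (R : ℝ), 0 < R →
      essSup (fun x => ∫⁻ y in (ball x₀ R)ᶜ, J x y ∂μ) (μ.restrict (ball x₀ (1 / 2 * R)))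
        ≤ T x₀ R) :
    ∀ᵐ y ∂μ, ∀ R : ℝ, 0 < R → ∃ (x₀ : M) (r : ℝ), R / 2 < r ∧ r ≤ R ∧ dist y x₀ ≤ R ∧
      ∫⁻ z in (ball y R)ᶜ, J y z ∂μ ≤ T x₀ r := by
  obtain ⟨D, hDc, hDd⟩ := TopologicalSpace.exists_countable_dense M
  have hgood : ∀ᵐ y ∂μ, ∀ x₀ ∈ D, ∀ q : ℚ, 0 < (q : ℝ) → y ∈ ball x₀ (1 / 2 * (q : ℝ)) →
      ∫⁻ z in (ball x₀ (q : ℝ))ᶜ, J y z ∂μ ≤ T x₀ q := by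
    rw [ae_ball_iff hDc]
    intro x₀ _
    rw [ae_all_iff]
    intro q
    by_cases hq : 0 < (q : ℝ)
    · have h := ENNReal.ae_le_essSup (μ := μ.restrict (ball x₀ (1 / 2 * (q : ℝ))))
        (fun x => ∫⁻ y in (ball x₀ (q : ℝ))ᶜ, J x y ∂μ)
      rw [ae_restrict_iff' measurableSet_ball] at h
      filter_upwards [h] with y hy _ hmem
      exact (hy hmem).trans (hT x₀ q hq)
    · exact Filter.Eventually.of_forall fun y h => absurd h hq
  filter_upwards [hgood] with y hy R hR
  obtain ⟨x₀, hx₀, hd⟩ := hDd.exists_dist_lt y (show 0 < R / 4 by positivity)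
  obtain ⟨q, hq1, hq2⟩ := exists_rat_btwn (show R / 2 < 3 * R / 4 by linarith)
  refine ⟨x₀, q, hq1, by linarith, by linarith, ?_⟩
  refine le_trans (lintegral_mono_set ?_)
    (hy x₀ hx₀ q (by linarith) (by rw [mem_ball]; linarith))
  exact compl_subset_compl.mpr (ball_subset_ball' (by rw [dist_comm]; linarith))

/-- `(VD) + (UJS) + (TJ) ⇒ (J≤)`: under volume doubling, upper jumping
smoothness and the tail condition for the jump kernel, the jump density
satisfies the pointwise upper bound `J(x,y) ≤ C/(V(x,d(x,y)) W(x,d(x,y)))`. -/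
theorem UJS_and_TJ_implies_Jle
    {M : Type*} [MetricSpace M] [MeasurableSpace M] [BorelSpace M]
    [LocallyCompactSpace M] [CompleteSpace M] [TopologicalSpace.SeparableSpace M]
    (μ : Measure M) [IsLocallyFiniteMeasure μ] [μ.IsOpenPosMeasure]
    -- volume doubling (VD)
    (CD : ℝ) (hCD : 1 ≤ CD)
    (hVD : ∀ (x : M) (R : ℝ), 0 < R →
      μ (ball x (2 * R)) ≤ ENNReal.ofReal CD * μ (ball x R))
    -- the scaling function W
    (W : M → ℝ → ℝ) (CW β1 β2 : ℝ) (hCW : 1 ≤ CW) (hβ1 : 0 < β1) (hβ12 : β1 ≤ β2)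
    (hWpos : ∀ x r, 0 < r → 0 < W x r)
    (hWmono : ∀ x, StrictMonoOn (W x) (Set.Ioi (0 : ℝ)))
    (hWcont : ∀ x, ContinuousOn (W x) (Set.Ioi (0 : ℝ)))
    (hWscale : ∀ (x y : M) (r R : ℝ), 0 < r → r ≤ R → dist x y ≤ R →
      CW⁻¹ * (R / r) ^ β1 ≤ W x R / W y r ∧ W x R / W y r ≤ CW * (R / r) ^ β2)
    -- the symmetric jump density
    (J : M → M → ℝ≥0∞) (hJmeas : Measurable (Function.uncurry J))
    (hJsymm : ∀ x y, J x y = J y x)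
    -- upper jumping smoothness (UJS)
    (CU : ℝ) (hCU : 0 < CU)
    (hUJS : ∀ᵐ p ∂(μ.prod μ), p.1 ≠ p.2 → ∀ r : ℝ, 0 < r → r ≤ dist p.1 p.2 / 2 →
      J p.1 p.2 ≤ (ENNReal.ofReal CU / μ (ball p.1 r)) *
        ∫⁻ z in ball p.1 r, J z p.2 ∂μ)
    -- tail of the jump measure (TJ)
    (hTJ : ∀ lam : ℝ, 0 < lam → lam < 1 → ∃ Clam : ℝ, 0 < Clam ∧
      ∀ (x₀ : M) (R : ℝ), 0 < R →
        essSup (fun x => ∫⁻ y in (ball x₀ R)ᶜ, J x y ∂μ)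
            (μ.restrict (ball x₀ (lam * R)))
          ≤ ENNReal.ofReal (Clam / W x₀ R)) :
    -- conclusion: (J≤)
    ∃ C : ℝ, 0 < C ∧ ∀ᵐ p ∂(μ.prod μ), p.1 ≠ p.2 →
      J p.1 p.2 ≤ ENNReal.ofReal C /
        (μ (ball p.1 (dist p.1 p.2)) * ENNReal.ofReal (W p.1 (dist p.1 p.2))) := by
  haveI : SecondCountableTopology M := UniformSpace.secondCountable_of_separable M
  obtain ⟨Cl, hCl, hT⟩ := hTJ (1 / 2) (by norm_num) (by norm_num)
  have hsnd := Measure.quasiMeasurePreserving_snd.ae (μa := μ.prod μ)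
    (ae_forall_tail_le μ J (fun x R => ENNReal.ofReal (Cl / W x R)) hT)
  have hCD0 : 0 < CD := by linarith
  have hCW0 : 0 < CW := by linarith
  refine ⟨CU * CD * (Cl * (CW * 8 ^ β2)), by positivity, ?_⟩
  filter_upwards [hUJS, hsnd] with ⟨x, y⟩ hU hS hne
  simp only at hU hS hne ⊢
  have hρ : 0 < dist x y := dist_pos.mpr hne
  specialize hU hne _ (half_pos hρ) le_rfl
  set ρ := dist x y with hρdef
  obtain ⟨x₀, r, hr1, hr2, hd, htail⟩ := hS _ (half_pos hρ)
  have hr : 0 < r := by linarith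
  have hint : ∫⁻ z in ball x (ρ / 2), J z y ∂μ ≤ ENNReal.ofReal (Cl / W x₀ r) := by
    refine le_trans ?_ htail
    simp_rw [fun z => hJsymm z y]
    refine lintegral_mono_set fun z hz => ?_
    rw [mem_ball] at hz
    rw [mem_compl_iff, mem_ball, not_lt]
    linarith [dist_triangle_left x y z]
  have hW : Cl / W x₀ r ≤ Cl * (CW * 8 ^ β2) / W x ρ := by
    have h1 := (hWscale x x₀ r (2 * ρ) hr (by linarith)
      (by linarith [dist_triangle x y x₀])).2
    have h2 : W x ρ ≤ W x (2 * ρ) :=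
      (hWmono x).monotoneOn hρ (show 0 < 2 * ρ by linarith) (by linarith)
    have h3 : (2 * ρ / r) ^ β2 ≤ 8 ^ β2 :=
      Real.rpow_le_rpow (by positivity) (by rw [div_le_iff₀ hr]; linarith) (by linarith)
    rw [div_le_iff₀ (hWpos x₀ r hr)] at h1
    rw [div_le_div_iff₀ (hWpos x₀ r hr) (hWpos x ρ hρ), mul_assoc]
    gcongr
    calc W x ρ ≤ CW * (2 * ρ / r) ^ β2 * W x₀ r := h2.trans h1
      _ ≤ CW * 8 ^ β2 * W x₀ r := by
        have := (hWpos x₀ r hr).le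
        gcongr
  have hV : (μ (ball x (ρ / 2)))⁻¹ ≤ ENNReal.ofReal CD * (μ (ball x ρ))⁻¹ := by
    have h := hVD x (ρ / 2) (half_pos hρ)
    rw [mul_div_cancel₀ ρ two_ne_zero] at h
    have hc0 : ENNReal.ofReal CD ≠ 0 := by simpa using hCD0
    rw [← ENNReal.inv_le_inv, ENNReal.mul_inv (.inl hc0) (.inl ENNReal.ofReal_ne_top)] at h
    calc (μ (ball x (ρ / 2)))⁻¹
        = ENNReal.ofReal CD * ((ENNReal.ofReal CD)⁻¹ * (μ (ball x (ρ / 2)))⁻¹) := by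
          rw [← mul_assoc, ENNReal.mul_inv_cancel hc0 ENNReal.ofReal_ne_top, one_mul]
      _ ≤ _ := by gcongr
  have hWρ := hWpos x ρ hρ
  calc J x y ≤ ENNReal.ofReal CU / μ (ball x (ρ / 2)) * ∫⁻ z in ball x (ρ / 2), J z y ∂μ := hU
    _ ≤ ENNReal.ofReal CU * (ENNReal.ofReal CD * (μ (ball x ρ))⁻¹) *
        ENNReal.ofReal (Cl * (CW * 8 ^ β2) / W x ρ) := by
      rw [div_eq_mul_inv]
      gcongr
      exact hint.trans (ENNReal.ofReal_le_ofReal hW)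
    _ = _ := by
      rw [ENNReal.ofReal_div_of_pos hWρ, ENNReal.ofReal_mul (by positivity : 0 ≤ CU * CD),
        ENNReal.ofReal_mul hCU.le, div_eq_mul_inv, div_eq_mul_inv,
        ENNReal.mul_inv (.inr ENNReal.ofReal_ne_top) (.inr (by simpa using hWρ))]
      ring
end

section
/- Let (M,d,μ) be a metric measure space satisfying the volume doubling property (VD), let W be a scaling function with constants C_W, β1, β2, and let J : M × M → [0,∞] be measurable. Assume (J≤): there exists C₀ > 0 such that for μ⊗μ-a.e. (x,y) with x ≠ y, J(x,y) ≤ C₀/(V(x,d(x,y))·W(x,d(x,y))). Then (TJ) holds: for every λ ∈ (0,1) there exists C_λ > 0 such that for every ball B = B(x₀,R), ess sup_{x ∈ λB} ∫_{M∖B} J(x,y) dμ(y) ≤ C_λ/W(x₀,R). -/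
open MeasureTheory Metric Set
open scoped ENNReal

/-- The integral over a dyadic tail of a kernel bounded by `C / (V(x,d) w(d))` is controlled by a
dyadic sum of `1 / w`. -/
theorem lintegral_tail_le_tsum {M : Type*} [MetricSpace M] [MeasurableSpace M] [BorelSpace M]
    (μ : Measure M) (D C : ℝ≥0∞) (x : M)
    (hVD : ∀ R : ℝ, 0 < R → μ (ball x (2 * R)) ≤ D * μ (ball x R))
    (w : ℝ → ℝ) (hwpos : ∀ r, 0 < r → 0 < w r) (hwmono : StrictMonoOn w (Set.Ioi (0 : ℝ)))
    (ρ : ℝ) (hρ : 0 < ρ) :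
    ∫⁻ y in {y | ρ ≤ dist x y}, C / (μ (ball x (dist x y)) * ENNReal.ofReal (w (dist x y))) ∂μ
      ≤ ∑' k : ℕ, C * D * (ENNReal.ofReal (w (2 ^ k * ρ)))⁻¹ := by
  have hcover : {y | ρ ≤ dist x y} ⊆
      ⋃ k : ℕ, {y | 2 ^ k * ρ ≤ dist x y ∧ dist x y < 2 * (2 ^ k * ρ)} := by
    intro y hy
    obtain ⟨k, hk₁, hk₂⟩ := exists_nat_pow_near (x := dist x y / ρ) (y := (2 : ℝ))
      ((one_le_div hρ).2 hy) one_lt_two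
    refine mem_iUnion.2 ⟨k, (le_div_iff₀ hρ).1 hk₁, ?_⟩
    have := (div_lt_iff₀ hρ).1 hk₂
    rw [pow_succ] at this
    linarith
  refine (lintegral_mono_set hcover).trans ((lintegral_iUnion_le _ _).trans ?_)
  refine ENNReal.tsum_le_tsum fun k => ?_
  set r : ℝ := 2 ^ k * ρ with hr
  have hr0 : 0 < r := by positivity
  calc ∫⁻ y in {y | r ≤ dist x y ∧ dist x y < 2 * r},
        C / (μ (ball x (dist x y)) * ENNReal.ofReal (w (dist x y))) ∂μ
      ≤ ∫⁻ _ in {y | r ≤ dist x y ∧ dist x y < 2 * r},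
        C / (μ (ball x r) * ENNReal.ofReal (w r)) ∂μ := by
        refine setLIntegral_mono measurable_const fun y hy => ?_
        have hw : w r ≤ w (dist x y) := hwmono.monotoneOn hr0 (hr0.trans_le hy.1) hy.1
        have hb := measure_mono (μ := μ) (ball_subset_ball (x := x) hy.1)
        gcongr
    _ ≤ C / (μ (ball x r) * ENNReal.ofReal (w r)) * (D * μ (ball x r)) := by
        rw [setLIntegral_const]
        gcongr
        refine (measure_mono fun y hy => ?_).trans (hVD r hr0)
        rw [mem_ball']
        exact hy.2
    _ = C * D * (ENNReal.ofReal (w r))⁻¹ * ((μ (ball x r))⁻¹ * μ (ball x r)) := by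
        rw [div_eq_mul_inv, ENNReal.mul_inv (Or.inr ENNReal.ofReal_ne_top)
          (Or.inr (ENNReal.ofReal_pos.2 (hwpos r hr0)).ne')]
        ring
    _ ≤ C * D * (ENNReal.ofReal (w r))⁻¹ := mul_le_of_le_one_right' (ENNReal.inv_mul_le_one _)

/-- `(VD) + (J≤) ⇒ (TJ)`: under volume doubling, the pointwise upper bound
`J(x,y) ≤ C₀/(V(x,d(x,y)) W(x,d(x,y)))` implies the tail condition for the jump
kernel. -/
theorem Jle_implies_TJ
    {M : Type*} [MetricSpace M] [MeasurableSpace M] [BorelSpace M]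
    [LocallyCompactSpace M] [CompleteSpace M] [TopologicalSpace.SeparableSpace M]
    (μ : Measure M) [IsLocallyFiniteMeasure μ] [μ.IsOpenPosMeasure]
    -- volume doubling (VD)
    (CD : ℝ) (hCD : 1 ≤ CD)
    (hVD : ∀ (x : M) (R : ℝ), 0 < R →
      μ (ball x (2 * R)) ≤ ENNReal.ofReal CD * μ (ball x R))
    -- the scaling function W
    (W : M → ℝ → ℝ) (CW β1 β2 : ℝ) (hCW : 1 ≤ CW) (hβ1 : 0 < β1) (hβ12 : β1 ≤ β2)
    (hWpos : ∀ x r, 0 < r → 0 < W x r)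
    (hWmono : ∀ x, StrictMonoOn (W x) (Set.Ioi (0 : ℝ)))
    (hWcont : ∀ x, ContinuousOn (W x) (Set.Ioi (0 : ℝ)))
    (hWscale : ∀ (x y : M) (r R : ℝ), 0 < r → r ≤ R → dist x y ≤ R →
      CW⁻¹ * (R / r) ^ β1 ≤ W x R / W y r ∧ W x R / W y r ≤ CW * (R / r) ^ β2)
    -- the jump density
    (J : M → M → ℝ≥0∞) (hJmeas : Measurable (Function.uncurry J))
    -- (J≤)
    (C₀ : ℝ) (hC₀ : 0 < C₀)
    (hJle : ∀ᵐ p ∂(μ.prod μ), p.1 ≠ p.2 →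
      J p.1 p.2 ≤ ENNReal.ofReal C₀ /
        (μ (ball p.1 (dist p.1 p.2)) * ENNReal.ofReal (W p.1 (dist p.1 p.2)))) :
    -- conclusion: (TJ)
    ∀ lam : ℝ, 0 < lam → lam < 1 → ∃ Clam : ℝ, 0 < Clam ∧
      ∀ (x₀ : M) (R : ℝ), 0 < R →
        essSup (fun x => ∫⁻ y in (ball x₀ R)ᶜ, J x y ∂μ)
            (μ.restrict (ball x₀ (lam * R)))
          ≤ ENNReal.ofReal (Clam / W x₀ R) := by
  intro lam hlam0 hlam1
  have : SecondCountableTopology M := UniformSpace.secondCountable_of_separable M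
  have hCW0 : 0 < CW := by linarith
  have hCD0 : 0 < CD := by linarith
  have hlam : 0 < 1 - lam := by linarith
  set q : ℝ := (2 ^ β1)⁻¹ with hq
  have hq0 : 0 < q := by positivity
  have hq1 : q < 1 := inv_lt_one_of_one_lt₀ (Real.one_lt_rpow one_lt_two hβ1)
  have hq2 : 0 < 1 - q := by linarith
  set A : ℝ := C₀ * CD * (CW * (CW * (1 / (1 - lam)) ^ β2)) with hA
  have hA0 : 0 < A := by positivity
  refine ⟨A * (1 - q)⁻¹, by positivity, fun x₀ R hR => ?_⟩
  refine essSup_le_of_ae_le _ ?_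
  filter_upwards [ae_restrict_of_ae (Measure.ae_ae_of_ae_prod hJle),
    ae_restrict_mem measurableSet_ball] with x hx hxB
  set ρ : ℝ := (1 - lam) * R with hρdef
  have hρ : 0 < ρ := by positivity
  have hρR : ρ ≤ R := by nlinarith
  have hxd : dist x x₀ < lam * R := hxB
  have hsub : (ball x₀ R)ᶜ ⊆ {y | ρ ≤ dist x y} := by
    intro y hy
    have h1 : R ≤ dist y x₀ := not_lt.1 hy
    have h2 := dist_triangle y x x₀
    rw [dist_comm y x] at h2
    simp only [mem_ofPred_eq]
    linarith
  have hmeas : MeasurableSet {y | ρ ≤ dist x y} :=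
    (isClosed_le continuous_const (by fun_prop)).measurableSet
  have hW0 := hWpos x₀ R hR
  have hterm : ∀ k : ℕ, C₀ * CD * (W x (2 ^ k * ρ))⁻¹ ≤ A / W x₀ R * q ^ k := by
    intro k
    have hk : 0 < (2 : ℝ) ^ k * ρ := by positivity
    have hρk : ρ ≤ 2 ^ k * ρ := le_mul_of_one_le_left hρ.le (one_le_pow₀ one_le_two)
    have hWρ := hWpos x ρ hρ
    have hWk := hWpos x _ hk
    have h1 := (hWscale x x ρ (2 ^ k * ρ) hρ hρk (by simpa using hk.le)).1
    have h2 := (hWscale x₀ x ρ R hρ hρR (by rw [dist_comm]; nlinarith)).2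
    have e1 : (2 ^ k * ρ / ρ) ^ β1 = (q ^ k)⁻¹ := by
      rw [mul_div_cancel_right₀ _ hρ.ne', hq, inv_pow, inv_inv, ← Real.rpow_natCast,
        ← Real.rpow_natCast, ← Real.rpow_mul zero_le_two, ← Real.rpow_mul zero_le_two, mul_comm]
    have e2 : R / ρ = 1 / (1 - lam) := by
      rw [hρdef]
      field_simp
    rw [e1, le_div_iff₀ hWρ] at h1
    rw [e2, div_le_iff₀ hWρ] at h2
    have hqk : 0 < q ^ k := by positivity
    have h3 : W x ρ ≤ CW * q ^ k * W x (2 ^ k * ρ) := by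
      have := mul_le_mul_of_nonneg_left h1 (by positivity : 0 ≤ CW * q ^ k)
      field_simp at this
      linarith
    have hP : 0 < CW * (1 / (1 - lam)) ^ β2 := by positivity
    have h4 := h2.trans (mul_le_mul_of_nonneg_left h3 hP.le)
    have h5 := mul_le_mul_of_nonneg_left h4 (by positivity : 0 ≤ C₀ * CD)
    rw [← div_eq_mul_inv, div_mul_eq_mul_div, div_le_div_iff₀ hWk hW0]
    refine h5.trans (le_of_eq ?_)
    rw [hA]
    ring
  calc ∫⁻ y in (ball x₀ R)ᶜ, J x y ∂μ
      ≤ ∫⁻ y in {y | ρ ≤ dist x y}, J x y ∂μ := lintegral_mono_set hsub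
    _ ≤ ∫⁻ y in {y | ρ ≤ dist x y},
        ENNReal.ofReal C₀ / (μ (ball x (dist x y)) * ENNReal.ofReal (W x (dist x y))) ∂μ := by
        refine lintegral_mono_ae ?_
        filter_upwards [ae_restrict_of_ae hx, ae_restrict_mem hmeas] with y hy hyρ
        exact hy (dist_pos.1 (hρ.trans_le hyρ))
    _ ≤ ∑' k : ℕ, ENNReal.ofReal C₀ * ENNReal.ofReal CD * (ENNReal.ofReal (W x (2 ^ k * ρ)))⁻¹ :=
        lintegral_tail_le_tsum μ _ _ x (hVD x) (W x) (hWpos x) (hWmono x) ρ hρ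
    _ ≤ ∑' k : ℕ, ENNReal.ofReal (A / W x₀ R * q ^ k) := by
        refine ENNReal.tsum_le_tsum fun k => ?_
        rw [← ENNReal.ofReal_inv_of_pos (hWpos x _ (by positivity)), ← ENNReal.ofReal_mul hC₀.le,
          ← ENNReal.ofReal_mul (by positivity)]
        exact ENNReal.ofReal_le_ofReal (hterm k)
    _ = ENNReal.ofReal (A * (1 - q)⁻¹ / W x₀ R) := by
        rw [← ENNReal.ofReal_tsum_of_nonneg (fun k => by positivity)
          ((summable_geometric_of_lt_one hq0.le hq1).mul_left _), tsum_mul_left,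
          tsum_geometric_of_lt_one hq0.le hq1]
        congr 1
        ring
end

section
/- Let θ ∈ (0,1), A > 0, C > 0 and K > 0, and let (M_n)_{n≥1} be a bounded sequence of nonnegative real numbers satisfying M_n ≤ C·2^{nA}·K^{θ/2}·(M_{n+1} + K)^{1−θ/2} for every n ≥ 1. Then there exists a constant C' depending only on θ, A and C (and not on K or the sequence) such that M_1 ≤ C'·K. -/
/-- A sequence bounded above with `d n ≤ q * d (n + 1)` for some `q ∈ [0, 1)` is nonpositive. -/
theorem nonpos_of_le_mul_succ {q L : ℝ} {d : ℕ → ℝ} (hq0 : 0 ≤ q) (hq1 : q < 1)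
    (hL : ∀ n, d n ≤ L) (hd : ∀ n, d n ≤ q * d (n + 1)) (n : ℕ) : d n ≤ 0 := by
  have hiter : ∀ k, d n ≤ q ^ k * d (n + k) := by
    intro k
    induction k with
    | zero => simp
    | succ k ih =>
      calc d n ≤ q ^ k * d (n + k) := ih
        _ ≤ q ^ k * (q * d (n + k + 1)) := by gcongr; exact hd _
        _ = q ^ (k + 1) * d (n + (k + 1)) := by rw [← add_assoc]; ring
  have hlim : Filter.Tendsto (fun k : ℕ => q ^ k * L) Filter.atTop (nhds 0) := by
    simpa using (tendsto_pow_atTop_nhds_zero_of_lt_one hq0 hq1).mul_const L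
  refine ge_of_tendsto' hlim fun k => (hiter k).trans ?_
  gcongr
  exact hL _

/-- A sequence bounded above with `y n ≤ a + n * b + q * y (n + 1)` for some `q ∈ [0, 1)` and
`b ≥ 0` lies below the affine solution of the corresponding recursion. -/
theorem le_affine_of_le_add_mul_succ {q a b L : ℝ} {y : ℕ → ℝ} (hq0 : 0 ≤ q) (hq1 : q < 1)
    (hb : 0 ≤ b) (hL : ∀ n, y n ≤ L) (hy : ∀ n, y n ≤ a + n * b + q * y (n + 1)) (n : ℕ) :
    y n ≤ (a + q * (b / (1 - q))) / (1 - q) + n * (b / (1 - q)) := by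
  have hq : 0 < 1 - q := sub_pos.2 hq1
  set t := b / (1 - q) with ht
  set s := (a + q * t) / (1 - q) with hs
  have ht0 : 0 ≤ t := div_nonneg hb hq.le
  have htb : t * (1 - q) = b := div_mul_cancel₀ _ hq.ne'
  have hsa : s * (1 - q) = a + q * t := div_mul_cancel₀ _ hq.ne'
  have hsol : ∀ m : ℕ, s + m * t = a + m * b + q * (s + (m + 1 : ℕ) * t) := by
    intro m
    push_cast
    linear_combination hsa + m * htb
  have h := nonpos_of_le_mul_succ (d := fun m => y m - (s + m * t)) (L := L - s) hq0 hq1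
    (fun m => by
      have : 0 ≤ (m : ℝ) * t := by positivity
      linarith [hL m])
    (fun m => by linarith [hy m, hsol m]) n
  linarith

/-- Backward iteration lemma: a bounded nonnegative sequence satisfying
`M_n ≤ C·2^{nA}·K^{θ/2}·(M_{n+1}+K)^{1-θ/2}` for all `n ≥ 1` satisfies
`M_1 ≤ C'·K`, with `C'` depending only on `θ`, `A` and `C`. -/
theorem backward_iteration_lemma
    (θ A C : ℝ) (hθ : 0 < θ) (hθ1 : θ < 1) (hA : 0 < A) (hC : 0 < C) :
    ∃ C' : ℝ, 0 < C' ∧ ∀ (K : ℝ) (Mseq : ℕ → ℝ), 0 < K →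
      (∀ n, 0 ≤ Mseq n) → (∃ L : ℝ, ∀ n, Mseq n ≤ L) →
      (∀ n : ℕ, 1 ≤ n →
        Mseq n ≤ C * 2 ^ ((n : ℝ) * A) * K ^ (θ / 2) * (Mseq (n + 1) + K) ^ (1 - θ / 2)) →
      Mseq 1 ≤ C' * K := by
  have hq0 : 0 ≤ 1 - θ / 2 := by linarith
  have hq1 : 1 - θ / 2 < 1 := by linarith
  set q := 1 - θ / 2 with hq
  set b := A * Real.log 2 with hb
  have hb0 : 0 ≤ b := by positivity
  set a := Real.log (C + 1) + b with ha
  refine ⟨Real.exp ((a + q * (b / (1 - q))) / (1 - q)), Real.exp_pos _, ?_⟩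
  rintro K M hK hM ⟨L, hL⟩ hrec
  have hx1 : ∀ n, 1 ≤ (M n + K) / K := fun n => by
    rw [le_div_iff₀ hK]; linarith [hM n]
  have hx0 : ∀ n, 0 < (M n + K) / K := fun n => one_pos.trans_le (hx1 n)
  have hstep : ∀ n, 1 ≤ n →
      (M n + K) / K ≤ (C + 1) * 2 ^ ((n : ℝ) * A) * ((M (n + 1) + K) / K) ^ q := by
    intro n hn
    have hone : 1 ≤ (2 : ℝ) ^ ((n : ℝ) * A) * ((M (n + 1) + K) / K) ^ q :=
      one_le_mul_of_one_le_of_one_le (Real.one_le_rpow one_le_two (by positivity))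
        (Real.one_le_rpow (hx1 _) hq0)
    have hKpow : K ^ (θ / 2) * K ^ q = K := by
      rw [← Real.rpow_add hK, hq, add_sub_cancel, Real.rpow_one]
    have hsplit : (M (n + 1) + K) ^ q = ((M (n + 1) + K) / K) ^ q * K ^ q := by
      rw [← Real.mul_rpow (hx0 _).le hK.le, div_mul_cancel₀ _ hK.ne']
    have hMn : M n ≤ C * 2 ^ ((n : ℝ) * A) * ((M (n + 1) + K) / K) ^ q * K := by
      refine (hrec n hn).trans_eq ?_
      rw [hsplit]
      linear_combination C * 2 ^ ((n : ℝ) * A) * ((M (n + 1) + K) / K) ^ q * hKpow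
    rw [div_le_iff₀ hK]
    linarith [mul_le_mul_of_nonneg_right hone hK.le]
  have hlog := le_affine_of_le_add_mul_succ (q := q) (a := a) (b := b)
    (L := Real.log ((L + K) / K)) (y := fun n => Real.log ((M (n + 1) + K) / K)) hq0 hq1 hb0
    (fun n => Real.log_le_log (hx0 _) (by gcongr; exact hL _))
    (fun n => by
      have h2 : (0 : ℝ) < 2 ^ (((n + 1 : ℕ) : ℝ) * A) := by positivity
      have hxq := Real.rpow_pos_of_pos (hx0 (n + 1 + 1)) q
      have h := Real.log_le_log (hx0 (n + 1)) (hstep (n + 1) (Nat.le_add_left 1 n))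
      rw [Real.log_mul (by positivity) hxq.ne', Real.log_mul (by positivity) h2.ne',
        Real.log_rpow two_pos, Real.log_rpow (hx0 _)] at h
      push_cast at h
      refine h.trans_eq ?_
      rw [ha, hb]
      ring) 0
  simp only [zero_add, Nat.cast_zero, zero_mul, add_zero] at hlog
  have hexp := (Real.log_le_iff_le_exp (hx0 1)).1 hlog
  rw [div_le_iff₀ hK] at hexp
  linarith
end

section
/- Let (M,d) be a metric space and W a scaling function with constants C_W ≥ 1 and 0 < β1 ≤ β2. Fix x₀ ∈ M, R₀ > 0, δ > 0, λ₀ ∈ (0, 1/2], Λ > 1, and r > 0 satisfying 3r/(1 − Λ^{-1}) ≤ λ₀·R₀ and (C_W/(1 − Λ^{-β1}))·(r/R₀)^{β1} ≤ 1/2. Let (t_n, y_n)_{n≥1} be a sequence in ℝ × M with d(x₀, y₁) < λ₀·R₀ and δ·W(x₀,R₀) < t₁ ≤ 2δ·W(x₀,R₀), and such that for every n ≥ 1: d(y_n, y_{n+1}) < 3·Λ^{1−n}·r and 0 ≤ t_n − t_{n+1} < δ·W(y_n, Λ^{1−n}·r). Then for every n ≥ 1: d(x₀, y_n) < 2·λ₀·R₀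 and t_n ∈ (½·δ·W(x₀,R₀), 2δ·W(x₀,R₀)]. -/
open Metric Set

/-- The lower bound in a scaling condition, read as an upper bound on the value at the smaller
scale. -/
theorem lower_scaling_upper_bound {w v C β s R : ℝ} (hC : 0 < C) (hs : 0 < s) (hR : 0 < R)
    (hw : 0 < w) (h : C⁻¹ * (R / s) ^ β ≤ v / w) : w ≤ C * (s / R) ^ β * v := by
  have hpos : 0 < (R / s) ^ β := Real.rpow_pos_of_pos (div_pos hR hs) _
  have hinv : (s / R) ^ β = ((R / s) ^ β)⁻¹ := by
    rw [← Real.inv_rpow (div_pos hR hs).le, inv_div]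
  rw [hinv]
  rw [le_div_iff₀ hw] at h
  calc w = C * ((R / s) ^ β)⁻¹ * (C⁻¹ * (R / s) ^ β * w) := by field_simp
    _ ≤ C * ((R / s) ^ β)⁻¹ * v := by gcongr

/-- Chain-containment lemma in Nash's blow-up argument: a sequence of
space-time points moving by controlled space and time increments stays inside
`B(x₀, 2λ₀R₀)` in space and inside `(½δW(x₀,R₀), 2δW(x₀,R₀)]` in time. -/
theorem nash_chain_containment
    {M : Type*} [MetricSpace M]
    (W : M → ℝ → ℝ) (CW β1 β2 : ℝ)
    (hCW : 1 ≤ CW) (hβ1 : 0 < β1) (hβ12 : β1 ≤ β2)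
    (hWpos : ∀ x r, 0 < r → 0 < W x r)
    (hWscale : ∀ (x y : M) (r R : ℝ), 0 < r → r ≤ R → dist x y ≤ R →
      CW⁻¹ * (R / r) ^ β1 ≤ W x R / W y r ∧ W x R / W y r ≤ CW * (R / r) ^ β2)
    (x₀ : M) (R₀ δ lam₀ Λ r : ℝ)
    (hR₀ : 0 < R₀) (hδ : 0 < δ) (hlam₀ : 0 < lam₀) (hlam₀' : lam₀ ≤ 1 / 2)
    (hΛ : 1 < Λ) (hr : 0 < r)
    (hgeom : 3 * r / (1 - Λ⁻¹) ≤ lam₀ * R₀)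
    (htime : CW / (1 - Λ ^ (-β1)) * (r / R₀) ^ β1 ≤ 1 / 2)
    (t : ℕ → ℝ) (y : ℕ → M)
    (hy1 : dist x₀ (y 1) < lam₀ * R₀)
    (ht1 : δ * W x₀ R₀ < t 1 ∧ t 1 ≤ 2 * δ * W x₀ R₀)
    (hstep : ∀ n : ℕ, 1 ≤ n →
      dist (y n) (y (n + 1)) < 3 * Λ ^ ((1 : ℝ) - n) * r ∧
      0 ≤ t n - t (n + 1) ∧
      t n - t (n + 1) < δ * W (y n) (Λ ^ ((1 : ℝ) - n) * r)) :
    ∀ n : ℕ, 1 ≤ n →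
      dist x₀ (y n) < 2 * lam₀ * R₀ ∧
      (1 / 2) * δ * W x₀ R₀ < t n ∧ t n ≤ 2 * δ * W x₀ R₀ := by
  have hΛ0 : 0 < Λ := by linarith
  have hC : 0 < CW := by linarith
  set q := Λ⁻¹ with hq
  set p := Λ ^ (-β1) with hp
  set V := W x₀ R₀ with hV
  have hq0 : 0 < q := inv_pos.2 hΛ0
  have hq1 : q < 1 := inv_lt_one_of_one_lt₀ hΛ
  have hp0 : 0 < p := Real.rpow_pos_of_pos hΛ0 _
  have hp1 : p < 1 := Real.rpow_lt_one_of_one_lt_of_neg hΛ (neg_neg_of_pos hβ1)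
  have hVpos : 0 < V := hWpos _ _ hR₀
  have hscale : ∀ k : ℕ, Λ ^ ((1 : ℝ) - (k + 1 : ℕ)) = q ^ k := fun k ↦ by
    rw [hq, inv_pow, ← Real.rpow_natCast, ← Real.rpow_neg hΛ0.le]
    congr 1
    push_cast
    ring
  have hgeom' : 3 * r ≤ lam₀ * R₀ * (1 - q) := (div_le_iff₀ (by linarith)).1 hgeom
  have htime' : CW * (r / R₀) ^ β1 ≤ 1 / 2 * (1 - p) := by
    rwa [div_mul_eq_mul_div, div_le_iff₀ (by linarith)] at htime
  have hlamR : lam₀ * R₀ ≤ 1 / 2 * R₀ := by gcongr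
  have hlamR0 : 0 < lam₀ * R₀ := by positivity
  have hrR : r ≤ R₀ := by nlinarith
  have key : ∀ k : ℕ, dist x₀ (y (k + 1)) < lam₀ * R₀ * (2 - q ^ k) ∧
      δ * V * (1 / 2 + 1 / 2 * p ^ k) < t (k + 1) ∧ t (k + 1) ≤ 2 * δ * V := by
    intro k
    induction k with
    | zero => exact ⟨by norm_num; exact hy1, by norm_num; exact ht1.1, ht1.2⟩
    | succ k ih =>
      obtain ⟨ihd, iht, ihu⟩ := ih
      obtain ⟨hd, hnonneg, hlt⟩ := hstep (k + 1) (by omega)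
      rw [hscale] at hd hlt
      have hqk : 0 < q ^ k := pow_pos hq0 k
      have hs : 0 < q ^ k * r := by positivity
      have hsR : q ^ k * r ≤ R₀ :=
        (mul_le_of_le_one_left hr.le (pow_le_one₀ hq0.le hq1.le)).trans hrR
      have hdist : dist x₀ (y (k + 1)) ≤ R₀ := by nlinarith [mul_pos hlamR0 hqk]
      have hW := lower_scaling_upper_bound hC hs hR₀ (hWpos _ _ hs)
        (hWscale x₀ (y (k + 1)) _ _ hs hsR hdist).1
      have hpow : (q ^ k * r / R₀) ^ β1 = p ^ k * (r / R₀) ^ β1 := by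
        rw [mul_div_assoc, Real.mul_rpow hqk.le (by positivity),
          ← Real.rpow_pow_comm hq0.le, hq, hp, Real.inv_rpow hΛ0.le, Real.rpow_neg hΛ0.le]
      have hWV : δ * W (y (k + 1)) (q ^ k * r) ≤ δ * V * (1 / 2 * (1 - p) * p ^ k) :=
        calc δ * W (y (k + 1)) (q ^ k * r)
            ≤ δ * (CW * (p ^ k * (r / R₀) ^ β1) * V) := by rw [← hpow]; gcongr
          _ = δ * V * (CW * (r / R₀) ^ β1 * p ^ k) := by ring
          _ ≤ δ * V * (1 / 2 * (1 - p) * p ^ k) := by gcongr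
      have hstepd : 3 * q ^ k * r ≤ lam₀ * R₀ * (1 - q) * q ^ k := by
        nlinarith [mul_le_mul_of_nonneg_right hgeom' hqk.le]
      refine ⟨?_, ?_, by linarith⟩
      · have htri := dist_triangle x₀ (y (k + 1)) (y (k + 1 + 1))
        rw [pow_succ]
        linarith
      · rw [pow_succ]
        linarith
  intro n hn
  obtain ⟨k, rfl⟩ := Nat.exists_eq_add_of_le' hn
  obtain ⟨hd, hl, hu⟩ := key k
  have hqk : 0 < lam₀ * R₀ * q ^ k := by positivity
  have hpk : 0 < δ * V * p ^ k := by positivity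
  exact ⟨by linarith, by linarith, hu⟩
end
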